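/- Let K be a field, V a finite-dimensional K-vector space, and N : V → V a nilpotent K-linear endomorphism. Let W : ℤ → Submodule K V be a weight filtration of N centered at 0, i.e. a monotone family with W_k = 0 for k ≪ 0, W_k = V for k ≫ 0, N(W_k) ⊆ W_{k−2} for all k, and such that N^k induces a bijection W_k/W_{k−1} → W_{−k}/W_{−k−1} for every k ≥ 0. Then for every k ≥ 0: (i) dim_K(W_k/W_{k−1}) = dim_K(W_{−k}/W_{−k−1}); and (ii) dim_K(W_k/W_{k−1}) − dim_K(W_{k+2}/W_{k+1}) = rank(N^k) − 2·rank(N^{k+1}) + rank(N^{k+2}), where rank denotes the dimension of the range; the right-hand side of (ii) is the number of Jordan blocks of N of size k+1. -/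

import Mathlib

/-- The map `W_k/W_{k-1} → W_{-k}/W_{-k-1}` induced by `N^k`, well defined thanks to the
hypotheses `h1` and `h2`. -/
noncomputable def gradedMap {K V : Type*} [Field K] [AddCommGroup V] [Module K V]
    (N : V →ₗ[K] V) (W : ℤ → Submodule K V) (k : ℕ)
    (h1 : ∀ x ∈ W (k : ℤ), (N ^ k) x ∈ W (-(k : ℤ)))
    (h2 : ∀ x ∈ W ((k : ℤ) - 1), (N ^ k) x ∈ W (-(k : ℤ) - 1)) :
    (↥(W (k : ℤ)) ⧸ Submodule.comap (W (k : ℤ)).subtype (W ((k : ℤ) - 1))) →ₗ[K]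
      (↥(W (-(k : ℤ))) ⧸ Submodule.comap (W (-(k : ℤ))).subtype (W (-(k : ℤ) - 1))) :=
  Submodule.mapQ _ _ ((N ^ k).restrict h1) (fun x hx => h2 x hx)

/-- `W` is a weight filtration of the nilpotent endomorphism `N` centered at `0`:
it is monotone, exhaustive, satisfies `N(W_k) ⊆ W_{k-2}` and `N^k` induces isomorphisms
`W_k/W_{k-1} ≅ W_{-k}/W_{-k-1}` for `k ≥ 0`. -/
def IsWeightFiltration {K V : Type*} [Field K] [AddCommGroup V] [Module K V]
    (N : V →ₗ[K] V) (W : ℤ → Submodule K V) : Prop :=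
  Monotone W ∧
  (∃ a : ℤ, ∀ k ≤ a, W k = ⊥) ∧
  (∃ b : ℤ, ∀ k, b ≤ k → W k = ⊤) ∧
  (∀ k : ℤ, (W k).map N ≤ W (k - 2)) ∧
  ∀ k : ℕ, ∃ (h1 : ∀ x ∈ W (k : ℤ), (N ^ k) x ∈ W (-(k : ℤ)))
    (h2 : ∀ x ∈ W ((k : ℤ) - 1), (N ^ k) x ∈ W (-(k : ℤ) - 1)),
    Function.Bijective (gradedMap N W k h1 h2)


/-- The dimension of the `j`-th graded piece `W_j / W_{j-1}` of a filtration. -/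
noncomputable def grDim {K V : Type*} [Field K] [AddCommGroup V] [Module K V]
    (W : ℤ → Submodule K V) (j : ℤ) : ℕ :=
  Module.finrank K (↥(W j) ⧸ Submodule.comap (W j).subtype (W (j - 1)))

namespace IsWeightFiltration

variable {K V : Type*} [Field K] [AddCommGroup V] [Module K V]
  {N : V →ₗ[K] V} {W : ℤ → Submodule K V}

theorem pow_apply_mem (hW : IsWeightFiltration N W) (m : ℕ) {i : ℤ} {x : V} (hx : x ∈ W i) :
    (N ^ m) x ∈ W (i - 2 * m) := by
  induction m with
  | zero => simpa using hx
  | succ m ih =>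
    have h := hW.2.2.2.1 _ (Submodule.mem_map_of_mem ih)
    rw [pow_succ', Module.End.mul_apply]
    convert h using 2
    push_cast
    ring

theorem mem_of_pow_apply_mem (hW : IsWeightFiltration N W) {k : ℕ} {x : V} (hx : x ∈ W k)
    (h : (N ^ k) x ∈ W (-(k : ℤ) - 1)) : x ∈ W ((k : ℤ) - 1) := by
  obtain ⟨h1, h2, hb⟩ := hW.2.2.2.2 k
  have h0 : gradedMap N W k h1 h2 (Submodule.Quotient.mk ⟨x, hx⟩) = 0 :=
    (Submodule.Quotient.mk_eq_zero _).2 h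
  have hq := hb.1 (h0.trans (map_zero _).symm)
  rwa [Submodule.Quotient.mk_eq_zero] at hq

theorem exists_sub_pow_apply_mem (hW : IsWeightFiltration N W) {k : ℕ} {y : V}
    (hy : y ∈ W (-(k : ℤ))) : ∃ x ∈ W k, y - (N ^ k) x ∈ W (-(k : ℤ) - 1) := by
  obtain ⟨h1, h2, hb⟩ := hW.2.2.2.2 k
  obtain ⟨q, hq⟩ := hb.2 (Submodule.Quotient.mk ⟨y, hy⟩)
  obtain ⟨⟨x, hx⟩, rfl⟩ := Submodule.Quotient.mk_surjective _ q
  have hyx : Submodule.Quotient.mk (p := Submodule.comap (W (-(k : ℤ))).subtype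
      (W (-(k : ℤ) - 1))) ⟨y, hy⟩ = Submodule.Quotient.mk ⟨(N ^ k) x, h1 x hx⟩ := hq.symm
  rw [Submodule.Quotient.eq] at hyx
  exact ⟨x, hx, hyx⟩

theorem ker_pow_le (hW : IsWeightFiltration N W) (m : ℕ) :
    LinearMap.ker (N ^ m) ≤ W ((m : ℤ) - 1) := by
  intro x hx
  rw [LinearMap.mem_ker] at hx
  have descend : ∀ t : ℕ, x ∈ W ((m : ℤ) - 1 + t) → x ∈ W ((m : ℤ) - 1) := by
    intro t
    induction t with
    | zero => simp
    | succ t ih =>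
      intro h
      apply ih
      have hk : (m : ℤ) - 1 + (t + 1 : ℕ) = (m + t : ℕ) := by push_cast; ring
      rw [hk] at h
      have hz : (N ^ (m + t)) x = 0 := by
        rw [add_comm, pow_add, Module.End.mul_apply, hx, map_zero]
      have h' := hW.mem_of_pow_apply_mem h (hz ▸ zero_mem _)
      convert h' using 2
      push_cast
      ring
  obtain ⟨b, hb⟩ := hW.2.2.1
  refine descend (b - (m - 1)).toNat ?_
  rw [hb _ (by omega)]
  trivial

theorem map_pow_eq (hW : IsWeightFiltration N W) (m : ℕ) {i : ℤ} (hi : i ≤ m) :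
    (W i).map (N ^ m) = W (i - 2 * m) := by
  apply le_antisymm
  · rintro _ ⟨x, hx, rfl⟩
    exact hW.pow_apply_mem m hx
  obtain ⟨a, ha⟩ := hW.2.1
  have climb : ∀ t : ℕ, ∀ i : ℤ, i ≤ m → i - 2 * m ≤ a + t →
      W (i - 2 * m) ≤ (W i).map (N ^ m) := by
    intro t
    induction t with
    | zero =>
      intro i _ h
      rw [ha _ (by simpa using h)]
      exact bot_le
    | succ t ih =>
      intro i hi h y hy
      obtain ⟨l, hl⟩ := Int.eq_ofNat_of_zero_le (sub_nonneg.2 hi)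
      have hj : i - 2 * m = -((l + m : ℕ) : ℤ) := by push_cast; omega
      rw [hj] at hy
      obtain ⟨x, hx, hxy⟩ := hW.exists_sub_pow_apply_mem hy
      rw [← hj, show i - 2 * m - 1 = (i - 1) - 2 * m by ring] at hxy
      obtain ⟨z, hz, hzy⟩ := ih (i - 1) (by omega) (by push_cast at h; omega) hxy
      refine ⟨z + (N ^ l) x, add_mem (hW.1 (by omega) hz) ?_, ?_⟩
      · convert hW.pow_apply_mem l hx using 2
        push_cast
        omega
      · rw [map_add, hzy, ← Module.End.mul_apply, ← pow_add, add_comm m l, sub_add_cancel]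
  exact climb (i - 2 * m - a).toNat i hi (by omega)

theorem finrank_range_pow [FiniteDimensional K V] (hW : IsWeightFiltration N W) (m : ℕ)
    {i j : ℤ} (hi : i = m - 1) (hj : j = -m - 1) :
    (Module.finrank K (LinearMap.range (N ^ m)) : ℤ) =
      Module.finrank K V - Module.finrank K (W i) + Module.finrank K (W j) := by
  obtain rfl : j = i - 2 * m := by omega
  have hker : LinearMap.ker (N ^ m) ≤ W i := hi ▸ hW.ker_pow_le m
  have h1 := LinearMap.finrank_range_add_finrank_ker (N ^ m)
  have h2 := LinearMap.finrank_range_add_finrank_ker ((N ^ m).domRestrict (W i))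
  rw [LinearMap.range_domRestrict, hW.map_pow_eq m (by omega), LinearMap.ker_domRestrict,
    (Submodule.comapSubtypeEquivOfLe hker).finrank_eq] at h2
  omega

theorem grDim_eq_sub [FiniteDimensional K V] (hW : IsWeightFiltration N W) {i j : ℤ}
    (hi : i = j - 1) :
    (grDim W j : ℤ) = Module.finrank K (W j) - Module.finrank K (W i) := by
  subst hi
  have h := Submodule.finrank_quotient_add_finrank (Submodule.comap (W j).subtype (W (j - 1)))
  rw [(Submodule.comapSubtypeEquivOfLe (hW.1 (by omega : j - 1 ≤ j))).finrank_eq] at h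
  unfold grDim
  omega

theorem grDim_neg (hW : IsWeightFiltration N W) {j : ℤ} (hj : 0 ≤ j) :
    grDim W j = grDim W (-j) := by
  lift j to ℕ using hj
  obtain ⟨_, _, hb⟩ := hW.2.2.2.2 j
  exact (LinearEquiv.ofBijective _ hb).finrank_eq

end IsWeightFiltration

/-- For a weight filtration `W` of a nilpotent endomorphism `N`:
(i) the graded pieces in degrees `k` and `-k` have the same dimension, and
(ii) `dim(W_k/W_{k-1}) - dim(W_{k+2}/W_{k+1}) = rank N^k - 2·rank N^{k+1} + rank N^{k+2}`,
the number of Jordan blocks of `N` of size `k+1`. -/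
theorem weight_filtration_graded_dims {K V : Type*} [Field K] [AddCommGroup V] [Module K V]
    [FiniteDimensional K V] (N : V →ₗ[K] V) (hN : IsNilpotent N)
    (W : ℤ → Submodule K V) (hW : IsWeightFiltration N W) :
    ∀ k : ℕ,
      grDim W (k : ℤ) = grDim W (-(k : ℤ)) ∧
      (grDim W (k : ℤ) : ℤ) - grDim W ((k : ℤ) + 2) =
        (Module.finrank K ↥(LinearMap.range (N ^ k)) : ℤ) -
          2 * Module.finrank K ↥(LinearMap.range (N ^ (k + 1))) +
          Module.finrank K ↥(LinearMap.range (N ^ (k + 2))) := by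
  intro k
  refine ⟨hW.grDim_neg (by omega), ?_⟩
  have s1 := hW.grDim_neg (j := k + 1) (by omega)
  have s2 := hW.grDim_neg (j := k + 2) (by omega)
  have d0 := hW.grDim_eq_sub (j := k) (i := k - 1) (by omega)
  have d1 := hW.grDim_eq_sub (j := k + 1) (i := k) (by omega)
  have d1' := hW.grDim_eq_sub (j := -(k + 1)) (i := -(k + 2)) (by omega)
  have d2' := hW.grDim_eq_sub (j := -(k + 2)) (i := -(k + 3)) (by omega)
  rw [hW.finrank_range_pow k (i := k - 1) (j := -(k + 1)) (by omega) (by omega),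
    hW.finrank_range_pow (k + 1) (i := k) (j := -(k + 2)) (by omega) (by omega),
    hW.finrank_range_pow (k + 2) (i := k + 1) (j := -(k + 3)) (by omega) (by omega)]
  omega
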